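/- In the real space ℓ¹ = ℓ¹({k∈ℕ : k ≥ 1};ℝ), for each integer k ≥ 1 define B_k = {x ∈ ℓ¹ : x_k ≥ 1} and D_k = {x ∈ ℓ¹ : x_k ≤ −(2^k − 1)/2^k}. Then (⋂_{k≥1} B_k^1) ∩ (⋂_{k≥1} D_k^1) = {x ∈ ℓ¹ : 0 ≤ x_k ≤ 2^{-k} for every k ≥ 1}; in particular this intersection of 1-enlargements is nonempty and bounded. -/

import Mathlib

open Metric

/-- The `ε`-enlargement of a set `A`: points at distance at most `ε` from `A`. -/
def enl {X : Type*} [NormedAddCommGroup X] (A : Set X) (ε : ℝ) : Set X :=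
  {x : X | infDist x A ≤ ε}

/-- In `ℓ¹`, the `ε`-enlargement of the half-space `{y | a ≤ y k}` is `{x | a - ε ≤ x k}`. -/
lemma mem_enl_le_coord_iff (k : ℕ+) (a : ℝ) {ε : ℝ} (hε : 0 ≤ ε)
    (x : lp (fun _ : ℕ+ => ℝ) 1) :
    x ∈ enl {y : lp (fun _ : ℕ+ => ℝ) 1 | a ≤ y k} ε ↔ a - ε ≤ x k := by
  constructor
  · intro h
    refine le_of_forall_pos_lt_add fun δ hδ => ?_
    have hne : {y : lp (fun _ : ℕ+ => ℝ) 1 | a ≤ y k}.Nonempty :=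
      ⟨lp.single 1 k a, by simp⟩
    obtain ⟨y, hy, hxy⟩ :=
      (infDist_lt_iff hne).1 (lt_of_le_of_lt (show infDist x _ ≤ ε from h)
        (lt_add_of_pos_right ε hδ))
    have hk := lp.norm_apply_le_norm one_ne_zero (x - y) k
    rw [← dist_eq_norm, lp.coeFn_sub, Pi.sub_apply, Real.norm_eq_abs] at hk
    have hy : a ≤ y k := hy
    linarith [neg_abs_le (x k - y k)]
  · intro h
    have hy : x + lp.single 1 k ε ∈ {y : lp (fun _ : ℕ+ => ℝ) 1 | a ≤ y k} := by
      simp only [Set.mem_ofPred_eq, lp.coeFn_add, Pi.add_apply, lp.single_apply_self]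
      linarith
    refine (infDist_le_dist_of_mem hy).trans ?_
    rw [dist_self_add_right, lp.norm_single one_pos, Real.norm_of_nonneg hε]

/-- In `ℓ¹`, the `ε`-enlargement of the half-space `{y | y k ≤ a}` is `{x | x k ≤ a + ε}`. -/
lemma mem_enl_coord_le_iff (k : ℕ+) (a : ℝ) {ε : ℝ} (hε : 0 ≤ ε)
    (x : lp (fun _ : ℕ+ => ℝ) 1) :
    x ∈ enl {y : lp (fun _ : ℕ+ => ℝ) 1 | y k ≤ a} ε ↔ x k ≤ a + ε := by
  constructor
  · intro h
    refine le_of_forall_pos_lt_add fun δ hδ => ?_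
    have hne : {y : lp (fun _ : ℕ+ => ℝ) 1 | y k ≤ a}.Nonempty :=
      ⟨lp.single 1 k a, by simp⟩
    obtain ⟨y, hy, hxy⟩ :=
      (infDist_lt_iff hne).1 (lt_of_le_of_lt (show infDist x _ ≤ ε from h)
        (lt_add_of_pos_right ε hδ))
    have hk := lp.norm_apply_le_norm one_ne_zero (x - y) k
    rw [← dist_eq_norm, lp.coeFn_sub, Pi.sub_apply, Real.norm_eq_abs] at hk
    have hy : y k ≤ a := hy
    linarith [le_abs_self (x k - y k)]
  · intro h
    have hy : x - lp.single 1 k ε ∈ {y : lp (fun _ : ℕ+ => ℝ) 1 | y k ≤ a} := by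
      simp only [Set.mem_ofPred_eq, lp.coeFn_sub, Pi.sub_apply, lp.single_apply_self]
      linarith
    refine (infDist_le_dist_of_mem hy).trans ?_
    rw [dist_eq_norm, sub_sub_cancel, lp.norm_single one_pos, Real.norm_of_nonneg hε]

/-- An order interval `[0, b]` in `ℓ¹` with summable upper bound `b` is norm bounded. -/
lemma isBounded_setOf_nonneg_le {b : ℕ+ → ℝ} (hb : Summable b) :
    Bornology.IsBounded {x : lp (fun _ : ℕ+ => ℝ) 1 | ∀ k, 0 ≤ x k ∧ x k ≤ b k} := by
  refine isBounded_iff_forall_norm_le.2 ⟨∑' k, b k, fun x hx => ?_⟩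
  have hnorm : ∀ k, ‖x k‖ ≤ b k := fun k => by
    rw [Real.norm_of_nonneg (hx k).1]
    exact (hx k).2
  have hsum : Summable fun k => ‖x k‖ := hb.of_nonneg_of_le (fun k => norm_nonneg _) hnorm
  rw [lp.norm_eq_tsum_rpow (by simp)]
  simpa using hsum.tsum_le_tsum hnorm hb

/-- In `ℓ¹` (indexed by the positive integers), with `B_k = {x : x_k ≥ 1}` and
`D_k = {x : x_k ≤ -(2^k - 1)/2^k}`, the intersection of all the `1`-enlargements equals
`{x : 0 ≤ x_k ≤ 2^{-k} for all k}`; in particular it is nonempty and bounded. -/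
theorem l1_example_one_enlargements_inter :
    let B : ℕ+ → Set (lp (fun _ : ℕ+ => ℝ) 1) := fun k => {x | 1 ≤ x k}
    let D : ℕ+ → Set (lp (fun _ : ℕ+ => ℝ) 1) :=
      fun k => {x | x k ≤ -((2 ^ (k : ℕ) - 1) / 2 ^ (k : ℕ))}
    ((⋂ k, enl (B k) 1) ∩ ⋂ k, enl (D k) 1) =
      {x : lp (fun _ : ℕ+ => ℝ) 1 | ∀ k : ℕ+, 0 ≤ x k ∧ x k ≤ 1 / 2 ^ (k : ℕ)} ∧
    ((⋂ k, enl (B k) 1) ∩ ⋂ k, enl (D k) 1).Nonempty ∧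
    Bornology.IsBounded ((⋂ k, enl (B k) 1) ∩ ⋂ k, enl (D k) 1) := by
  intro B D
  have hset : ((⋂ k, enl (B k) 1) ∩ ⋂ k, enl (D k) 1) =
      {x : lp (fun _ : ℕ+ => ℝ) 1 | ∀ k : ℕ+, 0 ≤ x k ∧ x k ≤ 1 / 2 ^ (k : ℕ)} := by
    ext x
    simp only [Set.mem_inter_iff, Set.mem_iInter, Set.mem_ofPred_eq, ← forall_and]
    refine forall_congr' fun k => ?_
    have hpow : -((2 ^ (k : ℕ) - 1) / 2 ^ (k : ℕ)) + 1 = (1 / 2 ^ (k : ℕ) : ℝ) := by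
      field_simp
      ring
    rw [mem_enl_le_coord_iff k 1 zero_le_one, mem_enl_coord_le_iff k _ zero_le_one, hpow,
      sub_self]
  have hsum : Summable fun k : ℕ+ => (1 / 2 ^ (k : ℕ) : ℝ) := by
    simpa [Function.comp_def] using summable_geometric_two.comp_injective PNat.coe_injective
  refine ⟨hset, ?_, ?_⟩
  · rw [hset]
    exact ⟨0, fun k => ⟨le_rfl, by simp⟩⟩
  · rw [hset]
    exact isBounded_setOf_nonneg_le hsum
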